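/- arXiv:math/0506411 — 2 statements merged into one kernel-verified Lean document; each statement's English description precedes it below -/
import Mathlib

section
/- Let I ⊆ ℝ be an open interval, Q ∈ L²_loc(I; ℝ), q = Q', and let y be a solution of L_q y = 0 on I (in the system sense). If y(x) ≥ 0 for all x in some neighborhood of a point x₀ ∈ I and y(x₀) = 0, then y ≡ 0 on I. In particular, a nonnegative solution of L_q y = 0 on I is either identically zero or strictly positive everywhere on I. -/
open MeasureTheory Filter Set intervalIntegral ENNReal

/-- `Q` is locally square integrable on the interval `I`. -/
def LocL2On (I : Set ℝ) (Q : ℝ → ℝ) : Prop :=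
  Measurable Q ∧ ∀ a b : ℝ, a ∈ I → b ∈ I → IntegrableOn (fun x => Q x ^ 2) (Set.Icc a b) volume

/-- `y` together with the companion function `u` (representing `u = y' - Q·y`) solves, on the
interval `I`, the first-order system `y' = Q y + u`, `u' = -Q² y - Q u` equivalent to
`L_q y = 0` with `q = Q'`, expressed through integral equations (encoding local absolute
continuity on `I`). -/
def SolvesWithOn (I : Set ℝ) (Q y u : ℝ → ℝ) : Prop :=
  ∀ a ∈ I, ∀ b ∈ I,
    y b = y a + (∫ t in a..b, (Q t * y t + u t)) ∧
    u b = u a + (∫ t in a..b, (-(Q t) ^ 2 * y t - Q t * u t))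

/-- A function satisfying `f b = f a + ∫ t in a..b, g t` throughout an open interval is continuous
there. No integrability of `g` is needed: if it fails, then `f` is constant. -/
lemma continuousOn_of_eq_add_integral {I : Set ℝ} (hIo : IsOpen I) {f g : ℝ → ℝ}
    (h : ∀ a ∈ I, ∀ b ∈ I, f b = f a + ∫ t in a..b, g t) : ContinuousOn f I := by
  by_cases hg : ∀ a ∈ I, ∀ b ∈ I, IntervalIntegrable g volume a b
  · intro x hx
    obtain ⟨ε, hε, hεI⟩ := Metric.nhds_basis_closedBall.mem_iff.1 (hIo.mem_nhds hx)
    rw [Real.closedBall_eq_Icc] at hεI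
    have hle : x - ε ≤ x + ε := by linarith
    have ha : x - ε ∈ I := hεI (left_mem_Icc.2 hle)
    have hint := hg _ ha _ (hεI (right_mem_Icc.2 hle))
    have hc : ContinuousOn (fun t => f (x - ε) + ∫ s in (x - ε)..t, g s)
        (Icc (x - ε) (x + ε)) := by
      refine continuousOn_const.add ?_
      rw [← uIcc_of_le hle]
      refine continuousOn_primitive_interval ?_
      rw [uIcc_of_le hle]
      exact (intervalIntegrable_iff_integrableOn_Icc_of_le hle).1 hint
    have hc' : ContinuousOn f (Icc (x - ε) (x + ε)) :=
      hc.congr fun t ht => h _ ha t (hεI ht)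
    exact (hc'.continuousAt (Icc_mem_nhds (by linarith) (by linarith))).continuousWithinAt
  · push Not at hg
    obtain ⟨a, ha, b, hb, hab⟩ := hg
    refine (continuousOn_const (c := f a)).congr fun x hx => ?_
    by_cases hax : IntervalIntegrable g volume a x
    · have hxb : ¬ IntervalIntegrable g volume x b := fun hxb => hab (hax.trans hxb)
      have h₁ := h x hx b hb
      have h₂ := h a ha b hb
      rw [integral_undef hxb] at h₁
      rw [integral_undef hab] at h₂
      linarith
    · have h₁ := h a ha x hx
      rwa [integral_undef hax, add_zero] at h₁

namespace SolvesWithOn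

variable {I : Set ℝ} {Q y u : ℝ → ℝ}

lemma continuousOn_fst (hIo : IsOpen I) (hy : SolvesWithOn I Q y u) : ContinuousOn y I :=
  continuousOn_of_eq_add_integral hIo fun a ha b hb => (hy a ha b hb).1

lemma continuousOn_snd (hIo : IsOpen I) (hy : SolvesWithOn I Q y u) : ContinuousOn u I :=
  continuousOn_of_eq_add_integral hIo fun a ha b hb => (hy a ha b hb).2

end SolvesWithOn

namespace LocL2On

variable {I : Set ℝ} {Q : ℝ → ℝ}

lemma intervalIntegrable_sq (hQ : LocL2On I Q) {a b : ℝ} (ha : a ∈ I) (hb : b ∈ I) :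
    IntervalIntegrable (fun t => Q t ^ 2) volume a b :=
  ⟨(hQ.2 a b ha hb).mono_set Ioc_subset_Icc_self, (hQ.2 b a hb ha).mono_set Ioc_subset_Icc_self⟩

lemma intervalIntegrable (hQ : LocL2On I Q) {a b : ℝ} (ha : a ∈ I) (hb : b ∈ I) :
    IntervalIntegrable Q volume a b := by
  refine (intervalIntegrable_const (c := (1 : ℝ)).add
    (hQ.intervalIntegrable_sq ha hb)).mono_fun hQ.1.aestronglyMeasurable
    (Eventually.of_forall fun t => ?_)
  simp only [Real.norm_eq_abs]
  rw [abs_of_nonneg (by positivity : (0 : ℝ) ≤ 1 + Q t ^ 2)]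
  nlinarith [sq_abs (Q t), sq_nonneg (|Q t| - 1)]

lemma intervalIntegrable_weight (hQ : LocL2On I Q) {a b : ℝ} (ha : a ∈ I) (hb : b ∈ I) :
    IntervalIntegrable (fun t => 1 + |Q t| + Q t ^ 2) volume a b :=
  (intervalIntegrable_const.add (hQ.intervalIntegrable ha hb).abs).add
    (hQ.intervalIntegrable_sq ha hb)

/-- The weight `1 + |Q| + Q²` has small integral near every point of the interval. -/
lemma exists_integral_weight_le (hIo : IsOpen I) (hQ : LocL2On I Q) {x : ℝ} (hx : x ∈ I) :
    ∃ δ > 0, Icc (x - δ) (x + δ) ⊆ I ∧ ∀ t ∈ Icc (x - δ) (x + δ),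
      |∫ s in x..t, (1 + |Q s| + Q s ^ 2)| ≤ 1 / 4 := by
  have hc : ContinuousOn (fun t => ∫ s in x..t, (1 + |Q s| + Q s ^ 2)) I := by
    refine continuousOn_of_eq_add_integral (g := fun s => 1 + |Q s| + Q s ^ 2) hIo
      fun a ha b hb => ?_
    exact (integral_add_adjacent_intervals (hQ.intervalIntegrable_weight hx ha)
      (hQ.intervalIntegrable_weight ha hb)).symm
  have hat : Tendsto (fun t => ∫ s in x..t, (1 + |Q s| + Q s ^ 2)) (nhds x) (nhds 0) := by
    simpa [ContinuousAt] using hc.continuousAt (hIo.mem_nhds hx)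
  have hev := hat.eventually (Metric.closedBall_mem_nhds (0 : ℝ) (by norm_num : (0 : ℝ) < 1 / 4))
  obtain ⟨δ, hδ, hsub⟩ :=
    Metric.nhds_basis_closedBall.mem_iff.1 (inter_mem (hIo.mem_nhds hx) hev)
  rw [Real.closedBall_eq_Icc] at hsub
  exact ⟨δ, hδ, fun t ht => (hsub ht).1, fun t ht => by simpa using (hsub ht).2⟩

/-- If `|g| ≤ (1 + |Q| + Q²) M` between `x` and `t` and the weight has integral at most `1 / 4`,
then `g` has integral at most `M / 4`. -/
lemma abs_integral_le (hQ : LocL2On I Q) {x t M : ℝ} {g : ℝ → ℝ} (hx : x ∈ I) (ht : t ∈ I)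
    (hM : 0 ≤ M) (hw : |∫ s in x..t, (1 + |Q s| + Q s ^ 2)| ≤ 1 / 4)
    (hg : ∀ s ∈ uIcc x t, |g s| ≤ (1 + |Q s| + Q s ^ 2) * M) :
    |∫ s in x..t, g s| ≤ M / 4 := by
  have h₁ : ‖∫ s in x..t, g s‖ ≤ |∫ s in x..t, (1 + |Q s| + Q s ^ 2) * M| := by
    refine norm_integral_le_abs_of_norm_le ?_ ((hQ.intervalIntegrable_weight hx ht).mul_const M)
    exact (ae_restrict_mem measurableSet_uIoc).mono fun s hs => hg s (uIoc_subset_uIcc hs)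
  rw [intervalIntegral.integral_mul_const, abs_mul, abs_of_nonneg hM] at h₁
  rw [Real.norm_eq_abs] at h₁
  nlinarith

end LocL2On

namespace SolvesWithOn

variable {I : Set ℝ} {Q y u : ℝ → ℝ}

/-- A solution with zero Cauchy data at a point vanishes near that point. -/
lemma exists_eq_zero_of_eq_zero (hIo : IsOpen I) (hQ : LocL2On I Q) (hy : SolvesWithOn I Q y u)
    {x : ℝ} (hx : x ∈ I) (hyx : y x = 0) (hux : u x = 0) :
    ∃ δ > 0, ∀ t ∈ Icc (x - δ) (x + δ), t ∈ I ∧ y t = 0 ∧ u t = 0 := by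
  obtain ⟨δ, hδ, hsub, hw⟩ := hQ.exists_integral_weight_le hIo hx
  have hxm : x ∈ Icc (x - δ) (x + δ) := ⟨by linarith, by linarith⟩
  obtain ⟨m, hm, hmax⟩ := isCompact_Icc.exists_isMaxOn ⟨x, hxm⟩
    (((hy.continuousOn_fst hIo).mono hsub).abs.add ((hy.continuousOn_snd hIo).mono hsub).abs)
  have hmax' : ∀ t ∈ Icc (x - δ) (x + δ), |y t| + |u t| ≤ |y m| + |u m| := fun t ht => hmax ht
  have hM : 0 ≤ |y m| + |u m| := by positivity
  have hseg : uIcc x m ⊆ Icc (x - δ) (x + δ) := ordConnected_Icc.uIcc_subset hxm hm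
  obtain ⟨h₁, h₂⟩ := hy x hx m (hsub hm)
  have hb₁ := hQ.abs_integral_le (g := fun t => Q t * y t + u t) hx (hsub hm) hM (hw m hm)
    fun s hs => by
      refine le_trans ?_ (mul_le_mul_of_nonneg_left (hmax' s (hseg hs)) (by positivity))
      refine (abs_add_le _ _).trans ?_
      rw [abs_mul]
      nlinarith [mul_nonneg (abs_nonneg (Q s)) (abs_nonneg (u s)), abs_nonneg (y s),
        mul_nonneg (sq_nonneg (Q s)) (add_nonneg (abs_nonneg (y s)) (abs_nonneg (u s)))]
  have hb₂ := hQ.abs_integral_le (g := fun t => -(Q t) ^ 2 * y t - Q t * u t) hx (hsub hm) hM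
    (hw m hm) fun s hs => by
      refine le_trans ?_ (mul_le_mul_of_nonneg_left (hmax' s (hseg hs)) (by positivity))
      refine (abs_sub _ _).trans ?_
      rw [abs_mul, abs_mul, abs_neg, abs_of_nonneg (sq_nonneg (Q s))]
      nlinarith [mul_nonneg (abs_nonneg (Q s)) (abs_nonneg (y s)), abs_nonneg (y s),
        abs_nonneg (u s), mul_nonneg (sq_nonneg (Q s)) (abs_nonneg (u s))]
  rw [hyx, zero_add] at h₁
  rw [hux, zero_add] at h₂
  rw [← h₁] at hb₁
  rw [← h₂] at hb₂
  refine ⟨δ, hδ, fun t ht => ⟨hsub ht, ?_, ?_⟩⟩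
  · exact abs_nonpos_iff.1 (by linarith [hmax' t ht, abs_nonneg (u t)])
  · exact abs_nonpos_iff.1 (by linarith [hmax' t ht, abs_nonneg (y t)])

/-- A solution with zero Cauchy data at a point of the interval vanishes identically. -/
lemma eq_zero_of_eq_zero (hIo : IsOpen I) (hIc : I.OrdConnected) (hQ : LocL2On I Q)
    (hy : SolvesWithOn I Q y u) {x₀ : ℝ} (hx₀ : x₀ ∈ I) (hyx : y x₀ = 0) (hux : u x₀ = 0) :
    ∀ x ∈ I, y x = 0 := by
  let Z : Set ℝ := {x | x ∈ I ∧ y x = 0 ∧ u x = 0}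
  have hZ : IsOpen Z := by
    refine isOpen_iff_mem_nhds.2 fun x hx => ?_
    obtain ⟨δ, hδ, h⟩ := hy.exists_eq_zero_of_eq_zero hIo hQ hx.1 hx.2.1 hx.2.2
    exact mem_of_superset (Icc_mem_nhds (by linarith) (by linarith)) h
  have hcl : closure Z ∩ I ⊆ Z := by
    rintro x ⟨hxZ, hxI⟩
    have hne : (nhdsWithin x Z).NeBot := mem_closure_iff_nhdsWithin_neBot.1 hxZ
    have key : ∀ {f : ℝ → ℝ}, ContinuousOn f I → (∀ t ∈ Z, f t = 0) → f x = 0 := by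
      intro f hf h
      have hlim : Tendsto f (nhdsWithin x Z) (nhds (f x)) :=
        (hf.continuousAt (hIo.mem_nhds hxI)).mono_left nhdsWithin_le_nhds
      exact tendsto_nhds_unique hlim (tendsto_const_nhds.congr'
        (eventually_mem_nhdsWithin.mono fun t ht => (h t ht).symm))
    exact ⟨hxI, key (hy.continuousOn_fst hIo) fun t ht => ht.2.1,
      key (hy.continuousOn_snd hIo) fun t ht => ht.2.2⟩
  have hsub : I ⊆ Z := hIc.isPreconnected.subset_of_closure_inter_subset hZ
    ⟨x₀, hx₀, hx₀, hyx, hux⟩ hcl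
  exact fun x hx => (hsub hx).2.1

/-- At a zero of `y` where `u` does not vanish, `y` takes negative values arbitrarily close by. -/
lemma exists_neg_of_ne_zero (hIo : IsOpen I) (hQ : LocL2On I Q) (hy : SolvesWithOn I Q y u)
    {x : ℝ} (hx : x ∈ I) (hyx : y x = 0) (hux : u x ≠ 0) {δ : ℝ} (hδ : 0 < δ) :
    ∃ t ∈ I, |t - x| < δ ∧ y t < 0 := by
  obtain ⟨δ₁, hδ₁, hsub₁, hw⟩ := hQ.exists_integral_weight_le hIo hx
  have hc : 0 < |u x| := abs_pos.2 hux
  obtain ⟨δ₂, hδ₂, hu⟩ := Metric.continuousAt_iff.1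
    ((hy.continuousOn_snd hIo).continuousAt (hIo.mem_nhds hx)) (|u x| / 4) (by positivity)
  obtain ⟨h, hh, hhlt⟩ := exists_between (lt_min hδ (lt_min hδ₁ hδ₂))
  obtain ⟨hhδ, hh₁, hh₂⟩ : h < δ ∧ h < δ₁ ∧ h < δ₂ := by simpa using hhlt
  have hsub₂ : Icc (x - h) (x + h) ⊆ Icc (x - δ₁) (x + δ₁) :=
    Icc_subset_Icc (by linarith) (by linarith)
  have hsub := hsub₂.trans hsub₁
  have hxm : x ∈ Icc (x - h) (x + h) := ⟨by linarith, by linarith⟩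
  have hcy := hy.continuousOn_fst hIo
  have hcu := hy.continuousOn_snd hIo
  obtain ⟨m, hm, hmax⟩ := isCompact_Icc.exists_isMaxOn ⟨x, hxm⟩ (hcy.mono hsub).abs
  have hmax' : ∀ t ∈ Icc (x - h) (x + h), |y t| ≤ |y m| := fun t ht => hmax ht
  have hest : ∀ t ∈ Icc (x - h) (x + h), |y t - u x * (t - x)| ≤ |y m| / 4 + |u x| / 4 * h := by
    intro t ht
    have hseg : uIcc x t ⊆ Icc (x - h) (x + h) := ordConnected_Icc.uIcc_subset hxm ht
    have hi₁ : IntervalIntegrable (fun s => Q s * y s) volume x t :=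
      (hQ.intervalIntegrable hx (hsub ht)).mul_continuousOn (hcy.mono (hseg.trans hsub))
    have hi₂ : IntervalIntegrable u volume x t := (hcu.mono (hseg.trans hsub)).intervalIntegrable
    have hsplit : y t - u x * (t - x) = (∫ s in x..t, Q s * y s) + ∫ s in x..t, (u s - u x) := by
      rw [(hy x hx t (hsub ht)).1, hyx, integral_add hi₁ hi₂,
        integral_sub hi₂ intervalIntegrable_const, intervalIntegral.integral_const, smul_eq_mul]
      ring
    have hb₁ := hQ.abs_integral_le (g := fun s => Q s * y s) hx (hsub ht) (abs_nonneg (y m))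
      (hw t (hsub₂ ht)) fun s hs => by
        rw [abs_mul]
        have := hmax' s (hseg hs)
        gcongr
        nlinarith [sq_nonneg (Q s)]
    have htx : |t - x| ≤ h := abs_le.2 ⟨by linarith [ht.1], by linarith [ht.2]⟩
    have hb₂ : ‖∫ s in x..t, (u s - u x)‖ ≤ |u x| / 4 * |t - x| := by
      refine norm_integral_le_of_norm_le_const fun s hs => ?_
      have hs' := hseg (uIoc_subset_uIcc hs)
      refine (hu ?_).le
      rw [Real.dist_eq]
      exact (abs_le.2 ⟨by linarith [hs'.1], by linarith [hs'.2]⟩ : |s - x| ≤ h).trans_lt hh₂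
    rw [hsplit]
    refine (abs_add_le _ _).trans (add_le_add hb₁ (hb₂.trans ?_))
    gcongr
  have hM : |y m| ≤ 5 / 3 * (|u x| * h) := by
    have h₁ := hest m hm
    have h₂ : |u x * (m - x)| ≤ |u x| * h := by
      rw [abs_mul]
      gcongr
      exact abs_le.2 ⟨by linarith [hm.1], by linarith [hm.2]⟩
    have h₃ := abs_sub_abs_le_abs_sub (y m) (u x * (m - x))
    linarith
  have hch : 0 < |u x| * h := by positivity
  obtain ⟨t, ht, hth, htc⟩ : ∃ t ∈ Icc (x - h) (x + h), |t - x| = h ∧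
      u x * (t - x) = -(|u x| * h) := by
    rcases lt_or_gt_of_ne hux with hneg | hpos
    · refine ⟨x + h, ⟨by linarith, le_rfl⟩, by simp [abs_of_pos hh], ?_⟩
      rw [abs_of_neg hneg]
      ring
    · refine ⟨x - h, ⟨le_rfl, by linarith⟩, by simp [abs_of_pos hh], ?_⟩
      rw [abs_of_pos hpos]
      ring
  refine ⟨t, hsub ht, hth.trans_lt hhδ, ?_⟩
  have := (abs_le.1 (hest t ht)).2
  linarith

end SolvesWithOn

/-- **Lemma (nonnegative solutions).** Let `I` be an open interval, `Q ∈ L²_loc(I)`, `q = Q'`,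
and `y` a solution of `L_q y = 0` on `I` (system sense). If `y ≥ 0` on a neighborhood of a
point `x₀ ∈ I` and `y x₀ = 0`, then `y ≡ 0` on `I`. In particular, a nonnegative solution on
`I` is either identically zero or strictly positive everywhere on `I`. -/
theorem nonneg_solution_dichotomy (I : Set ℝ) (hIo : IsOpen I) (hIc : I.OrdConnected)
    (Q : ℝ → ℝ) (hQ : LocL2On I Q) (y u : ℝ → ℝ) (hy : SolvesWithOn I Q y u) :
    (∀ x₀ ∈ I, y x₀ = 0 →
      (∃ δ > 0, ∀ x ∈ I, |x - x₀| < δ → 0 ≤ y x) → ∀ x ∈ I, y x = 0) ∧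
    ((∀ x ∈ I, 0 ≤ y x) → (∀ x ∈ I, y x = 0) ∨ (∀ x ∈ I, 0 < y x)) := by
  have main : ∀ x₀ ∈ I, y x₀ = 0 →
      (∃ δ > 0, ∀ x ∈ I, |x - x₀| < δ → 0 ≤ y x) → ∀ x ∈ I, y x = 0 := by
    rintro x₀ hx₀ hyx ⟨δ, hδ, hnonneg⟩
    refine hy.eq_zero_of_eq_zero hIo hIc hQ hx₀ hyx ?_
    by_contra hux
    obtain ⟨t, ht, htδ, hneg⟩ := hy.exists_neg_of_ne_zero hIo hQ hx₀ hyx hux hδ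
    exact (hnonneg t ht htδ).not_gt hneg
  refine ⟨main, fun hnonneg => ?_⟩
  by_cases hz : ∃ x₀ ∈ I, y x₀ = 0
  · obtain ⟨x₀, hx₀, hyx⟩ := hz
    exact Or.inl (main x₀ hx₀ hyx ⟨1, one_pos, fun x hx _ => hnonneg x hx⟩)
  · push Not at hz
    exact Or.inr fun x hx => lt_of_le_of_ne (hnonneg x hx) (hz x hx).symm
end

section
/- Let Q ∈ L²_loc(ℝ; ℝ), q = Q', and suppose L_q ≥ 0, i.e. ∫ φ'(x)² dx − 2∫ Q(x) φ(x) φ'(x) dx ≥ 0 for every φ ∈ C_c^∞(ℝ; ℝ). If y is a solution of L_q y = 0 on ℝ (in the system sense) and y(a) = y(b) = 0 for two distinct points a ≠ b, then y ≡ 0 on ℝ. Equivalently: a solution of L_q y = 0 which is not identically zero has at most one zero. -/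
open MeasureTheory Filter Set intervalIntegral ENNReal

/-- `Q : ℝ → ℝ` is (real-valued and) locally square integrable on `ℝ`. -/
def LocL2 (Q : ℝ → ℝ) : Prop :=
  Measurable Q ∧ ∀ a b : ℝ, IntegrableOn (fun x => Q x ^ 2) (Set.Icc a b) volume

/-- `y` together with the companion function `u` (representing `u = y' - Q·y`) solves the
first-order system `y' = Q y + u`, `u' = -Q² y - Q u` equivalent to `L_q y = 0` with `q = Q'`,
expressed through integral equations (encoding local absolute continuity). -/
def SolvesWith (Q y u : ℝ → ℝ) : Prop :=
  (∀ x : ℝ, y x = y 0 + ∫ t in (0:ℝ)..x, (Q t * y t + u t)) ∧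
  (∀ x : ℝ, u x = u 0 + ∫ t in (0:ℝ)..x, (-(Q t) ^ 2 * y t - Q t * u t))

/-- `y` solves `L_q y = 0` on `ℝ` in the system sense, `q = Q'`. -/
def Solves (Q y : ℝ → ℝ) : Prop := ∃ u : ℝ → ℝ, SolvesWith Q y u

/-- `L_q ≥ 0` for `q = Q'`: for every real-valued test function `φ`,
`∫ φ'² dx - 2 ∫ Q φ φ' dx ≥ 0` (the second term is the pairing `(q, φ²)`). -/
def LqNonneg (Q : ℝ → ℝ) : Prop :=
  ∀ φ : ℝ → ℝ, ContDiff ℝ (⊤ : ℕ∞) φ → HasCompactSupport φ →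
    0 ≤ (∫ x : ℝ, deriv φ x ^ 2) - 2 * ∫ x : ℝ, Q x * φ x * deriv φ x

/-- The Riccati relation `q = B(r) = r' + r²` for `q = Q'`: there is a constant `C` with
`r x + ∫₀ˣ r² = Q x + C` for almost every `x`. -/
def Riccati (Q r : ℝ → ℝ) : Prop :=
  ∃ C : ℝ, ∀ᵐ x : ℝ ∂volume, r x + (∫ s in (0:ℝ)..x, r s ^ 2) = Q x + C

/-- The weight that controls the coefficients of the first-order system. -/
noncomputable def coeffWeight (Q : ℝ → ℝ) (t : ℝ) : ℝ := 1 + |Q t| + Q t ^ 2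

lemma coeffWeight_nonneg (Q : ℝ → ℝ) (t : ℝ) : 0 ≤ coeffWeight Q t := by
  unfold coeffWeight; positivity

lemma LocL2.intervalIntegrable_sq {Q : ℝ → ℝ} (hQ : LocL2 Q) (a b : ℝ) :
    IntervalIntegrable (fun t => Q t ^ 2) volume a b :=
  IntegrableOn.intervalIntegrable (hQ.2 _ _)

lemma LocL2.intervalIntegrable {Q : ℝ → ℝ} (hQ : LocL2 Q) (a b : ℝ) :
    IntervalIntegrable Q volume a b := by
  refine ((hQ.intervalIntegrable_sq a b).add (intervalIntegrable_const (c := (1 : ℝ)))).mono_fun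
    hQ.1.aestronglyMeasurable (Eventually.of_forall fun t => ?_)
  simp only [Real.norm_eq_abs]
  rw [abs_of_nonneg (a := Q t ^ 2 + 1) (by positivity), abs_le]
  constructor <;> nlinarith [sq_nonneg (Q t - 1), sq_nonneg (Q t + 1)]

lemma LocL2.intervalIntegrable_coeffWeight {Q : ℝ → ℝ} (hQ : LocL2 Q) (a b : ℝ) :
    IntervalIntegrable (coeffWeight Q) volume a b :=
  (intervalIntegrable_const.add (hQ.intervalIntegrable a b).abs).add (hQ.intervalIntegrable_sq a b)

lemma abs_system_le_coeffWeight (Q : ℝ → ℝ) (t y u : ℝ) :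
    |Q t * y + u| + |-(Q t) ^ 2 * y - Q t * u| ≤ coeffWeight Q t * (|y| + |u|) := by
  have h1 : |Q t * y + u| ≤ |Q t| * |y| + |u| := by
    rw [← abs_mul]; exact abs_add_le _ _
  have h2 : |-(Q t) ^ 2 * y - Q t * u| ≤ Q t ^ 2 * |y| + |Q t| * |u| := by
    refine (abs_sub _ _).trans ?_
    rw [abs_mul, abs_mul, abs_neg, abs_of_nonneg (sq_nonneg (Q t))]
  unfold coeffWeight
  nlinarith [mul_nonneg (sq_nonneg (Q t)) (abs_nonneg u), abs_nonneg y]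

lemma continuousOn_of_eq_add_integral_s8 {y f : ℝ → ℝ} {p x : ℝ}
    (hf : IntervalIntegrable f volume p x)
    (hy : ∀ z ∈ uIcc p x, y z = y p + ∫ t in p..z, f t) : ContinuousOn y (uIcc p x) :=
  (continuousOn_const.add (continuousOn_primitive_interval' hf left_mem_uIcc)).congr hy

/-- A short-interval Gronwall estimate. -/
lemma abs_add_abs_le_two_mul {y u f g k : ℝ → ℝ} {p x : ℝ}
    (hk : IntervalIntegrable k volume p x) (hk0 : ∀ t, 0 ≤ k t)
    (hk2 : |∫ t in p..x, k t| ≤ 1 / 2)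
    (hf : IntervalIntegrable f volume p x) (hg : IntervalIntegrable g volume p x)
    (hfg : ∀ t, |f t| + |g t| ≤ k t * (|y t| + |u t|))
    (hy : ∀ z ∈ uIcc p x, y z = y p + ∫ t in p..z, f t)
    (hu : ∀ z ∈ uIcc p x, u z = u p + ∫ t in p..z, g t) :
    |y x| + |u x| ≤ 2 * (|y p| + |u p|) := by
  have hyc := continuousOn_of_eq_add_integral_s8 hf hy
  have huc := continuousOn_of_eq_add_integral_s8 hg hu
  obtain ⟨z, hz, hmax⟩ := isCompact_uIcc.exists_isMaxOn ⟨p, left_mem_uIcc⟩ (hyc.abs.add huc.abs)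
  set M := |y z| + |u z| with hM
  have hmax' : ∀ t ∈ uIcc p x, |y t| + |u t| ≤ M := fun t ht => hmax ht
  have hsub : uIcc p z ⊆ uIcc p x := uIcc_subset_uIcc left_mem_uIcc hz
  have hsub' : uIoc p z ⊆ uIoc p x := uIoc_subset_uIoc_of_uIcc_subset_uIcc hsub
  have hM0 : 0 ≤ M := by positivity
  have hf' := hf.mono_set hsub
  have hg' := hg.mono_set hsub
  have h1 : |∫ t in p..z, f t| ≤ ∫ t in uIoc p z, |f t| :=
    norm_integral_le_integral_norm_uIoc (f := f)
  have h2 : |∫ t in p..z, g t| ≤ ∫ t in uIoc p z, |g t| :=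
    norm_integral_le_integral_norm_uIoc (f := g)
  have hkx : IntegrableOn k (uIoc p x) := hk.def'
  have h3 : (∫ t in uIoc p z, |f t|) + (∫ t in uIoc p z, |g t|) ≤ ∫ t in uIoc p z, M * k t := by
    rw [← integral_add hf'.def'.abs hg'.def'.abs]
    refine setIntegral_mono_on (hf'.def'.abs.add hg'.def'.abs)
      ((hkx.mono_set hsub').const_mul M) measurableSet_uIoc fun t ht => ?_
    refine (hfg t).trans ?_
    rw [mul_comm]
    exact mul_le_mul_of_nonneg_right (hmax' t (hsub (uIoc_subset_uIcc ht))) (hk0 t)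
  have h4 : (∫ t in uIoc p z, k t) ≤ 1 / 2 := by
    refine le_trans (setIntegral_mono_set hkx (Eventually.of_forall hk0) hsub'.eventuallyLE) ?_
    refine le_trans ?_ hk2
    rw [← Real.norm_eq_abs, norm_integral_eq_norm_integral_uIoc]
    exact le_abs_self _
  rw [MeasureTheory.integral_const_mul] at h3
  have h5 : M ≤ |y p| + |u p| + M * (1 / 2) := by
    have e1 : |y z| ≤ |y p| + |∫ t in p..z, f t| := by rw [hy z hz]; exact abs_add_le _ _
    have e2 : |u z| ≤ |u p| + |∫ t in p..z, g t| := by rw [hu z hz]; exact abs_add_le _ _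
    have := mul_le_mul_of_nonneg_left h4 hM0
    linarith
  have := hmax' x right_mem_uIcc
  linarith

lemma exists_small_integral {k : ℝ → ℝ} (hk : ∀ a b, IntervalIntegrable k volume a b) (m : ℝ) :
    ∃ δ > 0, ∀ p, |p - m| < δ → |∫ t in p..m, k t| ≤ 1 / 2 := by
  have hc : Continuous fun x => ∫ t in m..x, k t := continuous_primitive hk m
  obtain ⟨δ, hδ, h⟩ := Metric.continuous_iff.1 hc m (1 / 2) (by norm_num)
  refine ⟨δ, hδ, fun p hp => ?_⟩
  have := h p hp
  rw [integral_same, dist_zero_right, Real.norm_eq_abs] at this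
  rw [integral_symm, abs_neg]
  exact this.le

/-- A function defined by an integral equation, where the integral is zero by convention when it
diverges, agrees to the right of every point with a continuous function. -/
lemma exists_continuousOn_eqOn_right {y f : ℝ → ℝ}
    (hy : ∀ x, y x = y 0 + ∫ t in (0 : ℝ)..x, f t) {m : ℝ} (hm : 0 ≤ m) :
    ∃ x > m, ∃ Y : ℝ → ℝ, ContinuousOn Y (Icc m x) ∧ EqOn y Y (Ioc m x) := by
  by_cases h : ∃ x > m, IntervalIntegrable f volume 0 x
  · obtain ⟨x, hx, hf⟩ := h
    refine ⟨x, hx, y, (continuousOn_of_eq_add_integral_s8 hf fun z _ => hy z).mono ?_, fun _ _ => rfl⟩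
    rw [uIcc_of_le (hm.trans hx.le)]
    exact Icc_subset_Icc_left hm
  · push Not at h
    refine ⟨m + 1, by simp, fun _ => y 0, continuousOn_const, fun z hz => ?_⟩
    rw [hy z, integral_undef (h z hz.1), add_zero]

lemma SolvesWith.intervalIntegrable_of_nonneg {Q y u : ℝ → ℝ} (hQ : LocL2 Q)
    (h : SolvesWith Q y u) {x : ℝ} (hx : 0 ≤ x) :
    IntervalIntegrable (fun t => Q t * y t + u t) volume 0 x ∧
      IntervalIntegrable (fun t => -(Q t) ^ 2 * y t - Q t * u t) volume 0 x := by
  obtain ⟨hy, hu⟩ := h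
  set f := fun t => Q t * y t + u t with hf
  set g := fun t => -(Q t) ^ 2 * y t - Q t * u t with hg
  set s : Set ℝ := {x | IntervalIntegrable f volume 0 x ∧ IntervalIntegrable g volume 0 x} with hs
  have hfg : ∀ t, |f t| + |g t| ≤ coeffWeight Q t * (|y t| + |u t|) := fun t =>
    abs_system_le_coeffWeight Q t (y t) (u t)
  have hmono : ∀ {p q : ℝ}, 0 ≤ p → p ≤ q → q ∈ s → p ∈ s := fun {p q} hp hpq hq => by
    have : uIcc 0 p ⊆ uIcc 0 q := uIcc_subset_uIcc left_mem_uIcc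
      (by rw [uIcc_of_le (hp.trans hpq)]; exact ⟨hp, hpq⟩)
    exact ⟨hq.1.mono_set this, hq.2.mono_set this⟩
  suffices Icc 0 x ⊆ s from this ⟨hx, le_rfl⟩
  refine IsClosed.Icc_subset_of_forall_exists_gt ?_ (by simp [hs]) ?_
  · refine isClosed_of_closure_subset fun m hm => ?_
    have hmI : m ∈ Icc 0 x :=
      closure_minimal inter_subset_right isClosed_Icc hm
    refine ⟨?_, hmI⟩
    by_contra hms
    have hlt : ∀ p, 0 ≤ p → p < m → p ∈ s := fun p hp hpm => by
      obtain ⟨q, hq1, hq2⟩ := mem_closure_iff.1 hm (Ioi p) isOpen_Ioi hpm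
      exact hmono hp (le_of_lt hq1) hq2.1
    have hm0 : 0 < m := by
      refine lt_of_le_of_ne hmI.1 fun h0 => hms ?_
      rw [← h0]; simp [hs]
    obtain ⟨δ, hδ, hsmall⟩ := exists_small_integral (hQ.intervalIntegrable_coeffWeight) m
    obtain ⟨p, hp1, hp2⟩ : ∃ p, max 0 (m - δ) < p ∧ p < m :=
      exists_between (max_lt hm0 (by linarith))
    have hp0 : 0 ≤ p := (le_max_left _ _).trans hp1.le
    have hpδ : m - δ < p := (le_max_right _ _).trans_lt hp1
    have hps := hlt p hp0 hp2
    have hbd : ∀ z ∈ Ico p m, |y z| + |u z| ≤ 2 * (|y p| + |u p|) := fun z hz => by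
      have hzs := hlt z (hp0.trans hz.1) hz.2
      have hfz := hps.1.symm.trans hzs.1
      have hgz := hps.2.symm.trans hzs.2
      have hsub : ∀ q ∈ uIcc p z, q ∈ s := fun q hq => by
        rw [uIcc_of_le hz.1] at hq
        exact hmono (hp0.trans hq.1) hq.2 hzs
      refine abs_add_abs_le_two_mul (hQ.intervalIntegrable_coeffWeight p z)
        (coeffWeight_nonneg Q) ?_ hfz hgz hfg (fun q hq => ?_) (fun q hq => ?_)
      · refine le_trans ?_ (hsmall p (by rw [abs_lt]; constructor <;> linarith))
        rw [abs_of_nonneg (integral_nonneg hz.1 fun t _ => coeffWeight_nonneg Q t),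
          abs_of_nonneg (integral_nonneg hp2.le fun t _ => coeffWeight_nonneg Q t)]
        exact integral_mono_interval le_rfl hz.1 hz.2.le
          (Eventually.of_forall (coeffWeight_nonneg Q)) (hQ.intervalIntegrable_coeffWeight p m)
      · rw [hy q, hy p, add_assoc, integral_add_adjacent_intervals hps.1
          (hps.1.symm.trans (hsub q hq).1)]
      · rw [hu q, hu p, add_assoc, integral_add_adjacent_intervals hps.2
          (hps.2.symm.trans (hsub q hq).2)]
    have hcont : ∀ {v φ : ℝ → ℝ}, (∀ x, v x = v 0 + ∫ t in (0 : ℝ)..x, φ t) →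
        (∀ z, 0 ≤ z → z < m → IntervalIntegrable φ volume 0 z) →
        AEStronglyMeasurable v (volume.restrict (Ico p m)) := fun {v φ} hv hφ => by
      refine ContinuousOn.aestronglyMeasurable (fun z hz => ?_) measurableSet_Ico
      obtain ⟨z', hz1, hz2⟩ := exists_between hz.2
      have h0z : 0 ≤ z' := hp0.trans (hz.1.trans hz1.le)
      have := continuousOn_of_eq_add_integral_s8 (hφ z' h0z hz2) fun z _ => hv z
      rw [uIcc_of_le h0z] at this
      refine (this z ⟨hp0.trans hz.1, hz1.le⟩).mono_of_mem_nhdsWithin ?_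
      filter_upwards [self_mem_nhdsWithin, mem_nhdsWithin_of_mem_nhds (Iio_mem_nhds hz1)]
        with t ht ht'
      exact ⟨hp0.trans ht.1, le_of_lt ht'⟩
    have hym := hcont hy fun z h1 h2 => (hlt z h1 h2).1
    have hum := hcont hu fun z h1 h2 => (hlt z h1 h2).2
    have hQm : AEStronglyMeasurable Q (volume.restrict (Ico p m)) := hQ.1.aestronglyMeasurable
    have hdom : IntegrableOn (fun t => coeffWeight Q t * (2 * (|y p| + |u p|))) (Ico p m) := by
      rw [integrableOn_Ico_iff_integrableOn_Ioo, ← integrableOn_Ioc_iff_integrableOn_Ioo,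
        ← intervalIntegrable_iff_integrableOn_Ioc_of_le hp2.le]
      exact (hQ.intervalIntegrable_coeffWeight p m).mul_const _
    have hint : ∀ φ : ℝ → ℝ, AEStronglyMeasurable φ (volume.restrict (Ico p m)) →
        (∀ t, |φ t| ≤ coeffWeight Q t * (|y t| + |u t|)) → IntervalIntegrable φ volume p m := by
      intro φ hφ hφ'
      rw [intervalIntegrable_iff_integrableOn_Ioc_of_le hp2.le,
        integrableOn_Ioc_iff_integrableOn_Ioo, ← integrableOn_Ico_iff_integrableOn_Ioo]
      refine Integrable.mono' hdom hφ ?_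
      filter_upwards [ae_restrict_mem measurableSet_Ico] with t ht
      exact (hφ' t).trans (mul_le_mul_of_nonneg_left (hbd t ht) (coeffWeight_nonneg Q t))
    refine hms ⟨hps.1.trans (hint f ((hQm.mul hym).add hum) fun t => ?_),
      hps.2.trans (hint g (((hQm.pow 2).neg.mul hym).sub (hQm.mul hum)) fun t => ?_)⟩
    · linarith [hfg t, abs_nonneg (g t)]
    · linarith [hfg t, abs_nonneg (f t)]
  · rintro m ⟨hms, hm⟩ X hX
    obtain ⟨x₁, hx₁, Y, hY, hyY⟩ := exists_continuousOn_eqOn_right hy hm.1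
    obtain ⟨x₂, hx₂, U, hU, huU⟩ := exists_continuousOn_eqOn_right hu hm.1
    have hX' : m < X := hX
    set q := min X (min x₁ x₂) with hq
    have hmq : m < q := lt_min hX (lt_min hx₁ hx₂)
    have hq1 : q ≤ x₁ := (min_le_right _ _).trans (min_le_left _ _)
    have hq2 : q ≤ x₂ := (min_le_right _ _).trans (min_le_right _ _)
    have hY' : ContinuousOn Y (uIcc m q) := by
      rw [uIcc_of_le hmq.le]; exact hY.mono (Icc_subset_Icc_right hq1)
    have hU' : ContinuousOn U (uIcc m q) := by
      rw [uIcc_of_le hmq.le]; exact hU.mono (Icc_subset_Icc_right hq2)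
    have e : ∀ t ∈ uIoc m q, y t = Y t ∧ u t = U t := fun t ht => by
      rw [uIoc_of_le hmq.le] at ht
      exact ⟨hyY ⟨ht.1, ht.2.trans hq1⟩, huU ⟨ht.1, ht.2.trans hq2⟩⟩
    refine ⟨q, ⟨hms.1.trans ?_, hms.2.trans ?_⟩, hmq, min_le_left _ _⟩
    · refine (((hQ.intervalIntegrable m q).mul_continuousOn hY').add
        hU'.intervalIntegrable).congr fun t ht => ?_
      simp [hf, (e t ht).1, (e t ht).2]
    · refine (((hQ.intervalIntegrable_sq m q).neg.mul_continuousOn hY').sub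
        ((hQ.intervalIntegrable m q).mul_continuousOn hU')).congr fun t ht => ?_
      simp [hg, (e t ht).1, (e t ht).2]

lemma LocL2.neg_comp_neg {Q : ℝ → ℝ} (hQ : LocL2 Q) : LocL2 fun x => -Q (-x) := by
  refine ⟨(hQ.1.comp measurable_neg).neg, fun a b => ?_⟩
  rcases le_or_gt a b with hab | hab
  · have := (IntervalIntegrable.iff_comp_neg).1 (hQ.intervalIntegrable_sq (-a) (-b))
    rw [neg_neg, neg_neg, intervalIntegrable_iff_integrableOn_Icc_of_le hab] at this
    simpa using this
  · simp [Icc_eq_empty (not_le.2 hab)]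

lemma SolvesWith.comp_neg {Q y u : ℝ → ℝ} (h : SolvesWith Q y u) :
    SolvesWith (fun x => -Q (-x)) (fun x => y (-x)) (fun x => -u (-x)) := by
  constructor <;> intro x <;> simp only [neg_zero]
  · have := integral_comp_neg (a := 0) (b := x) (fun t => Q t * y t + u t)
    rw [neg_zero, integral_symm 0] at this
    rw [h.1 (-x), ← neg_eq_iff_eq_neg.2 this, ← intervalIntegral.integral_neg]
    congr 2; ext t; ring
  · have := integral_comp_neg (a := 0) (b := x) (fun t => -(Q t) ^ 2 * y t - Q t * u t)
    rw [neg_zero, integral_symm 0] at this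
    rw [h.2 (-x), neg_add, ← this]
    congr 2; ext t; ring

lemma SolvesWith.intervalIntegrable {Q y u : ℝ → ℝ} (hQ : LocL2 Q)
    (h : SolvesWith Q y u) (p q : ℝ) :
    IntervalIntegrable (fun t => Q t * y t + u t) volume p q ∧
      IntervalIntegrable (fun t => -(Q t) ^ 2 * y t - Q t * u t) volume p q := by
  suffices H : ∀ x, IntervalIntegrable (fun t => Q t * y t + u t) volume 0 x ∧
      IntervalIntegrable (fun t => -(Q t) ^ 2 * y t - Q t * u t) volume 0 x from
    ⟨(H p).1.symm.trans (H q).1, (H p).2.symm.trans (H q).2⟩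
  intro x
  rcases le_total 0 x with hx | hx
  · exact h.intervalIntegrable_of_nonneg hQ hx
  · obtain ⟨h1, h2⟩ := h.comp_neg.intervalIntegrable_of_nonneg hQ.neg_comp_neg (neg_nonneg.2 hx)
    constructor
    · have := (IntervalIntegrable.iff_comp_neg).1 h1.neg
      rw [neg_neg, neg_zero] at this
      refine this.congr fun t _ => ?_
      simp only [Pi.neg_apply, neg_neg]; ring
    · have := (IntervalIntegrable.iff_comp_neg).1 h2
      rw [neg_neg, neg_zero] at this
      refine this.congr fun t _ => ?_
      simp only [neg_neg]; ring

lemma SolvesWith.eq_add_integral {Q y u : ℝ → ℝ} (hQ : LocL2 Q) (h : SolvesWith Q y u)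
    (p x : ℝ) :
    y x = y p + (∫ t in p..x, (Q t * y t + u t)) ∧
      u x = u p + ∫ t in p..x, (-(Q t) ^ 2 * y t - Q t * u t) := by
  have H := h.intervalIntegrable hQ
  rw [h.1 x, h.1 p, h.2 x, h.2 p, add_assoc, add_assoc,
    integral_add_adjacent_intervals (H 0 p).1 (H p x).1,
    integral_add_adjacent_intervals (H 0 p).2 (H p x).2]
  exact ⟨rfl, rfl⟩

lemma SolvesWith.continuous {Q y u : ℝ → ℝ} (hQ : LocL2 Q) (h : SolvesWith Q y u) :
    Continuous y ∧ Continuous u := by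
  have H := h.intervalIntegrable hQ
  exact ⟨(continuous_const.add (continuous_primitive (fun p q => (H p q).1) 0)).congr
      fun x => (h.1 x).symm,
    (continuous_const.add (continuous_primitive (fun p q => (H p q).2) 0)).congr
      fun x => (h.2 x).symm⟩

/-- Uniqueness for the Cauchy problem. -/
lemma SolvesWith.eq_zero {Q y u : ℝ → ℝ} (hQ : LocL2 Q) (h : SolvesWith Q y u) {a : ℝ}
    (hya : y a = 0) (hua : u a = 0) (x : ℝ) : y x = 0 := by
  obtain ⟨hyc, huc⟩ := h.continuous hQ
  have hcl : IsClosed {x | y x = 0 ∧ u x = 0} :=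
    (isClosed_eq hyc continuous_const).inter (isClosed_eq huc continuous_const)
  have hop : IsOpen {x | y x = 0 ∧ u x = 0} := by
    refine Metric.isOpen_iff.2 fun m ⟨hm1, hm2⟩ => ?_
    obtain ⟨δ, hδ, hsmall⟩ := exists_small_integral hQ.intervalIntegrable_coeffWeight m
    refine ⟨δ, hδ, fun z hz => ?_⟩
    have hk := hsmall z hz
    rw [integral_symm, abs_neg] at hk
    have := abs_add_abs_le_two_mul (hQ.intervalIntegrable_coeffWeight m z) (coeffWeight_nonneg Q)
      hk (h.intervalIntegrable hQ m z).1 (h.intervalIntegrable hQ m z).2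
      (fun t => abs_system_le_coeffWeight Q t (y t) (u t))
      (fun q _ => (h.eq_add_integral hQ m q).1) (fun q _ => (h.eq_add_integral hQ m q).2)
    rw [hm1, hm2, abs_zero, add_zero, mul_zero] at this
    have h1 := abs_nonneg (y z)
    have h2 := abs_nonneg (u z)
    exact ⟨abs_eq_zero.1 (by linarith), abs_eq_zero.1 (by linarith)⟩
  have := IsClopen.eq_univ ⟨hcl, hop⟩ ⟨a, hya, hua⟩
  exact (this ▸ mem_univ x : x ∈ {x | y x = 0 ∧ u x = 0}).1

lemma lpNorm_le_mul_lpNorm_of_ae_le_mul {α : Type*} [MeasurableSpace α] {μ : Measure α}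
    {f g : α → ℝ} {c : ℝ} (hc : 0 ≤ c) (hf : AEStronglyMeasurable f μ) (hg : MemLp g 2 μ)
    (h : ∀ᵐ x ∂μ, |f x| ≤ c * |g x|) : lpNorm f 2 μ ≤ c * lpNorm g 2 μ := by
  rw [← toReal_eLpNorm hf, ← toReal_eLpNorm hg.1, ← ENNReal.toReal_ofReal hc,
    ← ENNReal.toReal_mul]
  exact ENNReal.toReal_mono (ENNReal.mul_ne_top ENNReal.ofReal_ne_top hg.2.ne)
    (eLpNorm_le_mul_eLpNorm_of_ae_le_mul h 2)

/-- The Cauchy–Schwarz inequality for integrals of real functions. -/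
lemma abs_integral_mul_le_lpNorm_mul_lpNorm {α : Type*} [MeasurableSpace α] {μ : Measure α}
    {f g : α → ℝ} (hf : MemLp f 2 μ) (hg : MemLp g 2 μ) :
    |∫ x, f x * g x ∂μ| ≤ lpNorm f 2 μ * lpNorm g 2 μ := by
  have h := abs_real_inner_le_norm (hf.toLp f) (hg.toLp g)
  rw [Lp.norm_toLp, Lp.norm_toLp, L2.inner_def, toReal_eLpNorm hf.1, toReal_eLpNorm hg.1] at h
  convert h using 2
  refine integral_congr_ae ?_
  filter_upwards [hf.coeFn_toLp, hg.coeFn_toLp] with x hx hx'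
  simp [hx, hx', mul_comm]

lemma LocL2.memLp {Q : ℝ → ℝ} (hQ : LocL2 Q) (C D : ℝ) :
    MemLp Q 2 (volume.restrict (Ioc C D)) :=
  (memLp_two_iff_integrable_sq hQ.1.aestronglyMeasurable).2
    ((hQ.2 C D).mono_set Ioc_subset_Icc_self)

lemma integrable_of_memLp_two {f : ℝ → ℝ} {C D : ℝ}
    (hf : MemLp f 2 (volume.restrict (Ioc C D))) : IntegrableOn f (Ioc C D) :=
  hf.integrable one_le_two

lemma abs_primitive_le {f : ℝ → ℝ} {C D : ℝ} (hf : MemLp f 2 (volume.restrict (Ioc C D)))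
    {x : ℝ} (hx : x ∈ Icc C D) :
    |∫ t in C..x, f t| ≤ lpNorm (fun _ => (1 : ℝ)) 2 (volume.restrict (Ioc C D)) *
      lpNorm f 2 (volume.restrict (Ioc C D)) := by
  have h1 : |∫ t in C..x, f t| ≤ ∫ t in Ioc C D, |f t| := by
    refine (norm_integral_le_integral_norm_uIoc (f := f)).trans ?_
    rw [uIoc_of_le hx.1]
    exact setIntegral_mono_set (integrable_of_memLp_two hf).abs
      (Eventually.of_forall fun t => abs_nonneg _) (Ioc_subset_Ioc_right hx.2).eventuallyLE
  have h2 := abs_integral_mul_le_lpNorm_mul_lpNorm (memLp_const (1 : ℝ)) hf.abs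
  simp only [one_mul] at h2
  refine h1.trans ((le_abs_self _).trans (h2.trans_eq ?_))
  congr 1
  exact lpNorm_abs hf.1 2

lemma continuousOn_primitive_of_memLp {f : ℝ → ℝ} {C D : ℝ} (hCD : C ≤ D)
    (hf : MemLp f 2 (volume.restrict (Ioc C D))) :
    ContinuousOn (fun x => ∫ t in C..x, f t) (Icc C D) := by
  rw [← uIcc_of_le hCD]
  exact continuousOn_primitive_interval' ((intervalIntegrable_iff_integrableOn_Ioc_of_le hCD).2
    (integrable_of_memLp_two hf)) left_mem_uIcc

lemma memLp_mul_primitive {Q f : ℝ → ℝ} {C D : ℝ} (hCD : C ≤ D)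
    (hQ : MemLp Q 2 (volume.restrict (Ioc C D))) (hf : MemLp f 2 (volume.restrict (Ioc C D))) :
    MemLp (fun x => Q x * ∫ t in C..x, f t) 2 (volume.restrict (Ioc C D)) ∧
      lpNorm (fun x => Q x * ∫ t in C..x, f t) 2 (volume.restrict (Ioc C D)) ≤
        lpNorm (fun _ => (1 : ℝ)) 2 (volume.restrict (Ioc C D)) *
          lpNorm f 2 (volume.restrict (Ioc C D)) * lpNorm Q 2 (volume.restrict (Ioc C D)) := by
  have hm : AEStronglyMeasurable (fun x => Q x * ∫ t in C..x, f t)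
      (volume.restrict (Ioc C D)) :=
    hQ.1.mul (((continuousOn_primitive_of_memLp hCD hf).mono
      Ioc_subset_Icc_self).aestronglyMeasurable measurableSet_Ioc)
  have hb : ∀ᵐ x ∂(volume.restrict (Ioc C D)), |Q x * ∫ t in C..x, f t| ≤
      lpNorm (fun _ => (1 : ℝ)) 2 (volume.restrict (Ioc C D)) *
        lpNorm f 2 (volume.restrict (Ioc C D)) * |Q x| := by
    filter_upwards [ae_restrict_mem measurableSet_Ioc] with x hx
    rw [abs_mul, mul_comm]
    exact mul_le_mul_of_nonneg_right (abs_primitive_le hf (Ioc_subset_Icc_self hx)) (abs_nonneg _)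
  exact ⟨hQ.of_le_mul hm hb, lpNorm_le_mul_lpNorm_of_ae_le_mul
    (mul_nonneg lpNorm_nonneg lpNorm_nonneg) hm hQ hb⟩

lemma abs_integral_mul_primitive_mul_le {Q f g : ℝ → ℝ} {C D : ℝ} (hCD : C ≤ D)
    (hQ : MemLp Q 2 (volume.restrict (Ioc C D))) (hf : MemLp f 2 (volume.restrict (Ioc C D)))
    (hg : MemLp g 2 (volume.restrict (Ioc C D))) :
    |∫ x in Ioc C D, (Q x * ∫ t in C..x, f t) * g x| ≤
      lpNorm (fun _ => (1 : ℝ)) 2 (volume.restrict (Ioc C D)) *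
        lpNorm Q 2 (volume.restrict (Ioc C D)) * lpNorm f 2 (volume.restrict (Ioc C D)) *
          lpNorm g 2 (volume.restrict (Ioc C D)) := by
  obtain ⟨h1, h2⟩ := memLp_mul_primitive hCD hQ hf
  refine (abs_integral_mul_le_lpNorm_mul_lpNorm h1 hg).trans ?_
  refine (mul_le_mul_of_nonneg_right h2 lpNorm_nonneg).trans_eq (by ring)

/-- The quadratic form of `L_q`, evaluated on the primitive of `f` vanishing at `C`. -/
noncomputable def primitiveForm (Q : ℝ → ℝ) (C D : ℝ) (f : ℝ → ℝ) : ℝ :=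
  ∫ x in Ioc C D, (f x ^ 2 - 2 * ((Q x * ∫ t in C..x, f t) * f x))

lemma primitiveForm_add_le {Q : ℝ → ℝ} {C D : ℝ} (hCD : C ≤ D)
    (hQ : MemLp Q 2 (volume.restrict (Ioc C D))) {f : ℝ → ℝ}
    (hf : MemLp f 2 (volume.restrict (Ioc C D))) :
    ∃ A B : ℝ, ∀ e : ℝ → ℝ, MemLp e 2 (volume.restrict (Ioc C D)) →
      primitiveForm Q C D (f + e) ≤ primitiveForm Q C D f +
        A * lpNorm e 2 (volume.restrict (Ioc C D)) +
        B * lpNorm e 2 (volume.restrict (Ioc C D)) ^ 2 := by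
  set μ := volume.restrict (Ioc C D) with hμ
  set L := lpNorm (fun _ => (1 : ℝ)) 2 μ * lpNorm Q 2 μ with hL
  refine ⟨2 * lpNorm f 2 μ + 4 * (L * lpNorm f 2 μ), 1 + 2 * L, fun e he => ?_⟩
  have i1 := hf.integrable_mul he
  have i2 := he.integrable_sq
  have i3 := (memLp_mul_primitive hCD hQ hf).1.integrable_mul he
  have i4 := (memLp_mul_primitive hCD hQ he).1.integrable_mul hf
  have i5 := (memLp_mul_primitive hCD hQ he).1.integrable_mul he
  have i6 := hf.integrable_sq
  have i7 := (memLp_mul_primitive hCD hQ hf).1.integrable_mul hf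
  have key : primitiveForm Q C D (f + e) = primitiveForm Q C D f + 2 * (∫ x, f x * e x ∂μ) +
      (∫ x, e x * e x ∂μ) - 2 * (∫ x, (Q x * ∫ t in C..x, f t) * e x ∂μ) -
      2 * (∫ x, (Q x * ∫ t in C..x, e t) * f x ∂μ) -
      2 * (∫ x, (Q x * ∫ t in C..x, e t) * e x ∂μ) := by
    simp only [primitiveForm, ← MeasureTheory.integral_const_mul]
    have i2' : Integrable (fun x => e x * e x) μ := he.integrable_mul he
    rw [← hμ, ← MeasureTheory.integral_add, ← MeasureTheory.integral_add,
      ← MeasureTheory.integral_sub, ← MeasureTheory.integral_sub, ← MeasureTheory.integral_sub]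
    · refine integral_congr_ae ?_
      filter_upwards [ae_restrict_mem measurableSet_Ioc] with x hx
      have hI : ∀ {φ : ℝ → ℝ}, MemLp φ 2 μ → IntervalIntegrable φ volume C x := fun hφ => by
        rw [intervalIntegrable_iff_integrableOn_Ioc_of_le hx.1.le]
        exact (integrable_of_memLp_two hφ).mono_set (Ioc_subset_Ioc_right hx.2)
      have : ∫ t in C..x, (f + e) t = (∫ t in C..x, f t) + ∫ t in C..x, e t :=
        intervalIntegral.integral_add (hI hf) (hI he)
      rw [this]
      simp only [Pi.add_apply]
      ring
    all_goals first
      | exact i3.const_mul 2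
      | exact i4.const_mul 2
      | exact i5.const_mul 2
      | exact i1.const_mul 2
      | exact i2'
      | exact (i6.sub (i7.const_mul 2))
      | exact (i6.sub (i7.const_mul 2)).add (i1.const_mul 2)
      | exact ((i6.sub (i7.const_mul 2)).add (i1.const_mul 2)).add i2'
      | exact (((i6.sub (i7.const_mul 2)).add (i1.const_mul 2)).add i2').sub (i3.const_mul 2)
      | exact ((((i6.sub (i7.const_mul 2)).add (i1.const_mul 2)).add i2').sub
          (i3.const_mul 2)).sub (i4.const_mul 2)
  have b1 := (abs_le.1 (abs_integral_mul_le_lpNorm_mul_lpNorm hf he)).2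
  have b2 := (abs_le.1 (abs_integral_mul_le_lpNorm_mul_lpNorm he he)).2
  have b3 := (abs_le.1 (abs_integral_mul_primitive_mul_le hCD hQ hf he)).1
  have b4 := (abs_le.1 (abs_integral_mul_primitive_mul_le hCD hQ he hf)).1
  have b5 := (abs_le.1 (abs_integral_mul_primitive_mul_le hCD hQ he he)).1
  rw [key]
  simp only [← hμ, ← hL] at b3 b4 b5
  nlinarith

lemma LqNonneg.primitiveForm_nonneg_of_contDiff {Q : ℝ → ℝ} (hQ : LocL2 Q)
    (hpos : LqNonneg Q) {C D : ℝ} (hCD : C ≤ D) {g : ℝ → ℝ} (hg : ContDiff ℝ (⊤ : ℕ∞) g)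
    (hg0 : ∀ x ∉ Ioc C D, g x = 0)
    (hgint : ∫ t in C..D, g t = 0) : 0 ≤ primitiveForm Q C D g := by
  set φ : ℝ → ℝ := fun x => ∫ t in C..x, g t with hφ
  have hd : ∀ x, HasDerivAt φ (g x) x := fun x =>
    integral_hasDerivAt_right (hg.continuous.intervalIntegrable _ _)
      (hg.continuous.stronglyMeasurableAtFilter _ _) hg.continuous.continuousAt
  have hderiv : deriv φ = g := funext fun x => (hd x).deriv
  have hsm : ContDiff ℝ (⊤ : ℕ∞) φ := by
    refine contDiff_infty_iff_deriv.2 ⟨fun x => (hd x).differentiableAt, ?_⟩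
    rw [hderiv]; exact hg
  have hcs : HasCompactSupport φ := by
    refine HasCompactSupport.intro (isCompact_Icc (a := C) (b := D)) fun x hx => ?_
    rw [mem_Icc, not_and_or, not_le, not_le] at hx
    rcases hx with hx | hx
    · refine integral_zero_ae (Eventually.of_forall fun t ht => hg0 t fun ht' => ?_)
      rw [uIoc_of_ge hx.le] at ht
      exact absurd ht.2 (not_le.2 ht'.1)
    · have : ∫ t in D..x, g t = 0 :=
        integral_zero_ae (Eventually.of_forall fun t ht => hg0 t fun ht' => by
          rw [uIoc_of_le hx.le] at ht
          exact absurd ht.1 (not_lt.2 ht'.2))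
      rw [hφ]
      simp only
      rw [← integral_add_adjacent_intervals (hg.continuous.intervalIntegrable C D)
        (hg.continuous.intervalIntegrable D x), hgint, this, add_zero]
  have h := hpos φ hsm hcs
  have hgL : MemLp g 2 (volume.restrict (Ioc C D)) :=
    (hg.continuous.memLp_of_hasCompactSupport (HasCompactSupport.intro (isCompact_Icc (a := C)
      (b := D)) fun x hx => hg0 x fun hx' => hx (Ioc_subset_Icc_self hx'))).restrict _
  have i : Integrable (fun x => 2 * (Q x * φ x * g x)) (volume.restrict (Ioc C D)) :=
    ((memLp_mul_primitive hCD (hQ.memLp C D) hgL).1.integrable_mul hgL).const_mul 2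
  rw [hderiv, ← setIntegral_eq_integral_of_forall_compl_eq_zero (s := Ioc C D)
      (f := fun x => g x ^ 2) (fun x hx => by simp [hg0 x hx]),
    ← setIntegral_eq_integral_of_forall_compl_eq_zero (s := Ioc C D)
      (f := fun x => Q x * φ x * g x) (fun x hx => by simp [hg0 x hx]),
    ← MeasureTheory.integral_const_mul, ← MeasureTheory.integral_sub hgL.integrable_sq i] at h
  exact h

lemma LqNonneg.primitiveForm_nonneg {Q : ℝ → ℝ} (hQ : LocL2 Q) (hpos : LqNonneg Q) {c d : ℝ}
    (hcd : c ≤ d) {f : ℝ → ℝ} (hf : MemLp f 2 volume) (hf0 : ∀ x ∉ Icc c d, f x = 0)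
    (hfint : ∫ t in (c - 1)..(d + 1), f t = 0) :
    0 ≤ primitiveForm Q (c - 1) (d + 1) f := by
  set C := c - 1 with hC
  set D := d + 1 with hD
  have hCD : C ≤ D := by linarith
  set μ := volume.restrict (Ioc C D) with hμ
  have hfμ : MemLp f 2 μ := hf.restrict _
  obtain ⟨A, B, hAB⟩ := primitiveForm_add_le hCD (hQ.memLp C D) hfμ
  set χ : ContDiffBump ((c + d) / 2) :=
    ⟨(d - c) / 2 + 1 / 2, (d - c) / 2 + 1, by linarith, by linarith⟩ with hχ
  have hχ1 : ∀ x ∈ Icc c d, χ x = 1 := fun x hx => by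
    refine χ.one_of_mem_closedBall ?_
    rw [Metric.mem_closedBall, Real.dist_eq, abs_le]
    constructor <;> simp only [hχ] <;> linarith [hx.1, hx.2]
  have hχ0 : ∀ x ∉ Ioc C D, χ x = 0 := fun x hx => by
    refine χ.zero_of_le_dist (not_lt.1 fun h => hx ?_)
    rw [Real.dist_eq, abs_lt] at h
    simp only [hχ] at h
    exact ⟨by linarith [h.1], by linarith [h.2]⟩
  set η := χ.normed volume with hη
  have hη0 : ∀ x ∉ Ioc C D, η x = 0 := fun x hx => by
    rw [hη, χ.normed_def, hχ0 x hx, zero_div]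
  have hηint : ∫ t in C..D, η t = 1 := by
    rw [integral_of_le hCD, setIntegral_eq_integral_of_forall_compl_eq_zero hη0]
    exact χ.integral_normed
  have hηsm : ContDiff ℝ (⊤ : ℕ∞) η := χ.contDiff_normed
  have hηL : MemLp η 2 μ :=
    (hηsm.continuous.memLp_of_hasCompactSupport χ.hasCompactSupport_normed).restrict _
  set K := 1 + lpNorm (fun _ => (1 : ℝ)) 2 μ * lpNorm η 2 μ with hK
  have approx : ∀ ε > 0, ∃ r, 0 ≤ r ∧ r ≤ K * ε ∧
      0 ≤ primitiveForm Q C D f + A * r + B * r ^ 2 := by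
    intro ε hε
    obtain ⟨g, hgc, hgsm, hge⟩ := hf.exist_eLpNorm_sub_le (by simp) one_le_two hε
    have hgL : MemLp g 2 volume := hgsm.continuous.memLp_of_hasCompactSupport hgc
    set e₀ : ℝ → ℝ := fun x => χ x * g x - f x with he₀
    have he₀m : AEStronglyMeasurable e₀ volume :=
      (χ.continuous.aestronglyMeasurable.mul hgL.1).sub hf.1
    have he₀b : ∀ x, |e₀ x| ≤ 1 * |(f - g) x| := fun x => by
      have : e₀ x = - (χ x * (f - g) x) := by
        by_cases hx : x ∈ Icc c d
        · simp [he₀, hχ1 x hx]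
        · simp [he₀, hf0 x hx]
      rw [this, abs_neg, abs_mul, abs_of_nonneg χ.nonneg]
      exact mul_le_mul_of_nonneg_right χ.le_one (abs_nonneg _)
    have he₀L : MemLp e₀ 2 μ :=
      ((hf.sub hgL).of_le_mul he₀m (Eventually.of_forall he₀b)).restrict _
    have he₀n : lpNorm e₀ 2 μ ≤ ε := by
      refine (lpNorm_le_mul_lpNorm_of_ae_le_mul zero_le_one he₀m.restrict
        ((hf.sub hgL).restrict _) (Eventually.of_forall he₀b)).trans ?_
      rw [one_mul, ← toReal_eLpNorm ((hf.sub hgL).restrict _).1]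
      refine ENNReal.toReal_le_of_le_ofReal hε.le (le_trans ?_ hge)
      exact eLpNorm_mono_measure _ Measure.restrict_le_self
    set m := ∫ t in C..D, e₀ t with hm
    have hmb : |m| ≤ lpNorm (fun _ => (1 : ℝ)) 2 μ * lpNorm e₀ 2 μ :=
      abs_primitive_le he₀L ⟨hCD, le_rfl⟩
    set e : ℝ → ℝ := e₀ - m • η with he
    have heL : MemLp e 2 μ := he₀L.sub (hηL.const_smul m)
    have hen : lpNorm e 2 μ ≤ K * ε := by
      have h1 : lpNorm e 2 μ ≤ lpNorm e₀ 2 μ + lpNorm (m • η) 2 μ :=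
        lpNorm_sub_le he₀L one_le_two
      rw [lpNorm_const_smul, coe_nnnorm, Real.norm_eq_abs] at h1
      have h2 := mul_le_mul_of_nonneg_right (hmb.trans (mul_le_mul_of_nonneg_left he₀n
        lpNorm_nonneg)) (lpNorm_nonneg (f := η) (p := 2) (μ := μ))
      rw [hK]
      linarith
    refine ⟨lpNorm e 2 μ, lpNorm_nonneg, hen, le_trans ?_ (hAB e heL)⟩
    have hfe : f + e = fun x => χ x * g x - m * η x := by
      ext x; simp [he, he₀]; ring
    rw [hfe]
    refine hpos.primitiveForm_nonneg_of_contDiff hQ hCD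
      ((χ.contDiff.mul hgsm).sub (contDiff_const.mul hηsm)) (fun x hx => ?_) ?_
    · simp [hχ0 x hx, hη0 x hx]
    · have hI : ∀ {φ : ℝ → ℝ}, MemLp φ 2 μ → IntervalIntegrable φ volume C D := fun hφ =>
        (intervalIntegrable_iff_integrableOn_Ioc_of_le hCD).2 (integrable_of_memLp_two hφ)
      rw [← hfe]
      have h1 : ∫ t in C..D, (f + e) t = (∫ t in C..D, f t) + ∫ t in C..D, e t :=
        intervalIntegral.integral_add (hI hfμ) (hI heL)
      have h2 : ∫ t in C..D, e t = (∫ t in C..D, e₀ t) - ∫ t in C..D, (m • η) t :=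
        intervalIntegral.integral_sub (hI he₀L) (hI (hηL.const_smul m))
      have h3 : ∫ t in C..D, (m • η) t = m * ∫ t in C..D, η t :=
        intervalIntegral.integral_const_mul m η
      rw [h1, h2, h3, hfint, hηint, ← hm]
      ring
  choose! r hr0 hr1 hr2 using approx
  have hlim : Tendsto r (nhdsWithin 0 (Ioi 0)) (nhds 0) := by
    have h0 : Tendsto (fun ε : ℝ => K * ε) (nhdsWithin 0 (Ioi 0)) (nhds 0) := by
      have : Continuous fun ε : ℝ => K * ε := by fun_prop
      simpa using (this.tendsto 0).mono_left nhdsWithin_le_nhds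
    refine tendsto_of_tendsto_of_tendsto_of_le_of_le' tendsto_const_nhds h0 ?_ ?_
    · filter_upwards [self_mem_nhdsWithin] with ε hε using hr0 ε hε
    · filter_upwards [self_mem_nhdsWithin] with ε hε using hr1 ε hε
  have hlim' := ((hlim.const_mul A).const_add (primitiveForm Q C D f)).add
    ((hlim.pow 2).const_mul B)
  refine ge_of_tendsto (b := 0) (x := nhdsWithin (0 : ℝ) (Ioi 0)) (by simpa using hlim') ?_
  filter_upwards [self_mem_nhdsWithin] with ε hε using hr2 ε hε

lemma integral_mul_add_mul_eq_sub {v w f g : ℝ → ℝ} {a b : ℝ}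
    (hf : IntervalIntegrable f volume a b) (hg : IntervalIntegrable g volume a b)
    (hv : ∀ x, v x = v a + ∫ t in a..x, f t) (hw : ∀ x, w x = w a + ∫ t in a..x, g t) :
    ∫ t in a..b, (f t * w t + v t * g t) = v b * w b - v a * w a := by
  have hac : ∀ {φ : ℝ → ℝ} (c : ℝ), IntervalIntegrable φ volume a b →
      AbsolutelyContinuousOnInterval (fun x => c + ∫ t in a..x, φ t) a b := fun {φ} c hφ => by
    have h1 := hφ.absolutelyContinuousOnInterval_intervalIntegral (c := a) left_mem_uIcc
    have h2 : AbsolutelyContinuousOnInterval (fun _ : ℝ => c) a b :=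
      (LipschitzWith.const c).lipschitzOnWith.absolutelyContinuousOnInterval
    exact h2.add h1
  have hav : AbsolutelyContinuousOnInterval v a b := by rw [funext hv]; exact hac _ hf
  have haw : AbsolutelyContinuousOnInterval w a b := by rw [funext hw]; exact hac _ hg
  rw [← hav.integral_deriv_mul_eq_sub haw]
  refine intervalIntegral.integral_congr_ae ?_
  have hd : ∀ {ψ φ : ℝ → ℝ}, IntervalIntegrable φ volume a b →
      (∀ x, ψ x = ψ a + ∫ t in a..x, φ t) →
      ∀ᵐ x, x ∈ uIcc a b → deriv ψ x = φ x := fun {ψ φ} hφ hψ => by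
    filter_upwards [hφ.ae_hasDerivAt_integral] with x hx hxm
    rw [funext hψ]
    exact ((hx hxm a left_mem_uIcc).const_add (ψ a)).deriv
  filter_upwards [hd hf hv, hd hg hw] with x h1 h2 hx
  rw [h1 (uIoc_subset_uIcc hx), h2 (uIoc_subset_uIcc hx)]

/-- A solution vanishing at both ends of an interval has vanishing quasi-derivative at the left
end: otherwise a variation of its extension by zero makes the quadratic form negative. -/
lemma SolvesWith.quasiDeriv_eq_zero {Q y u : ℝ → ℝ} (hQ : LocL2 Q) (hpos : LqNonneg Q)
    (h : SolvesWith Q y u) {a b : ℝ} (hab : a < b) (ha : y a = 0) (hb : y b = 0) : u a = 0 := by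
  obtain ⟨hyc, huc⟩ := h.continuous hQ
  have hint := h.intervalIntegrable hQ
  have heq := h.eq_add_integral hQ
  have hba : 0 < b - a := sub_pos.2 hab
  set κ := (b - a)⁻¹ with hκ
  have hκ1 : (b - a) * κ = 1 := mul_inv_cancel₀ hba.ne'
  set A := (∫ x in (a - 1)..a, (1 - 2 * (Q x * (x - (a - 1))))) +
    ∫ x in a..b, (κ ^ 2 + 2 * (Q x * ((b - x) * κ) * κ)) with hA
  have key : ∀ s : ℝ, 0 ≤ s ^ 2 * A - 2 * s * u a := by
    intro s
    set f : ℝ → ℝ := fun t => (Ioc (a - 1) a).indicator (fun _ => s) t +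
      (Ioc a b).indicator (fun t => Q t * y t + u t - s * κ) t with hf
    have f1 : ∀ t, t ≤ a - 1 → f t = 0 := fun t ht => by
      simp only [hf]
      rw [indicator_of_notMem (fun h => absurd h.1 (not_lt.2 ht)),
        indicator_of_notMem (fun h => absurd h.1 (not_lt.2 (by linarith))), add_zero]
    have f2 : ∀ t ∈ Ioc (a - 1) a, f t = s := fun t ht => by
      simp only [hf]
      rw [indicator_of_mem ht,
        indicator_of_notMem (fun h => absurd h.1 (not_lt.2 ht.2)), add_zero]
    have f3 : ∀ t ∈ Ioc a b, f t = Q t * y t + u t - s * κ := fun t ht => by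
      simp only [hf]
      rw [indicator_of_mem ht,
        indicator_of_notMem (fun h => absurd h.2 (not_le.2 ht.1)), zero_add]
    have f4 : ∀ t, b < t → f t = 0 := fun t ht => by
      simp only [hf]
      rw [indicator_of_notMem (fun h => absurd h.2 (not_le.2 (by linarith))),
        indicator_of_notMem (fun h => absurd h.2 (not_le.2 ht)), add_zero]
    have hfL : MemLp f 2 volume := by
      refine MemLp.add ?_ ?_
      · rw [memLp_indicator_iff_restrict measurableSet_Ioc]
        exact memLp_const s
      · rw [memLp_indicator_iff_restrict measurableSet_Ioc]
        have hm : AEStronglyMeasurable (fun t => Q t * y t + u t - s * κ)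
            (volume.restrict (Ioc a b)) :=
          ((hQ.1.mul hyc.measurable).add huc.measurable).sub_const _ |>.aestronglyMeasurable
        rw [memLp_two_iff_integrable_sq hm]
        have i := (((hQ.intervalIntegrable_sq a b).mul_continuousOn
          (hyc.pow 2).continuousOn).add ((hQ.intervalIntegrable a b).mul_continuousOn
          (by fun_prop : Continuous fun t => 2 * y t * (u t - s * κ)).continuousOn)).add
          ((by fun_prop : Continuous fun t => (u t - s * κ) ^ 2).intervalIntegrable a b)
        refine ((intervalIntegrable_iff_integrableOn_Ioc_of_le hab.le).1
          (i.congr fun t _ => ?_) : IntegrableOn _ _ _)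
        simp only [Pi.pow_apply]
        ring
    have hfI : ∀ p q, IntervalIntegrable f volume p q := fun p q =>
      ⟨(hfL.restrict (Ioc p q)).integrable one_le_two,
        (hfL.restrict (Ioc q p)).integrable one_le_two⟩
    have p1 : ∀ x, x ≤ a - 1 → ∫ t in (a - 1 - 1)..x, f t = 0 := fun x hx =>
      integral_zero_ae (Eventually.of_forall fun t ht => f1 t (ht.2.trans (by simp [hx])))
    have p2 : ∀ x ∈ Icc (a - 1) a, ∫ t in (a - 1 - 1)..x, f t = s * (x - (a - 1)) := by
      intro x hx
      rw [← integral_add_adjacent_intervals (hfI _ (a - 1)) (hfI _ _), p1 _ le_rfl, zero_add,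
        intervalIntegral.integral_congr_ae (g := fun _ => s),
        intervalIntegral.integral_const, smul_eq_mul, mul_comm]
      refine Eventually.of_forall fun t ht => f2 t ?_
      rw [uIoc_of_le hx.1] at ht
      exact ⟨ht.1, ht.2.trans hx.2⟩
    have p3 : ∀ x ∈ Icc a b, ∫ t in (a - 1 - 1)..x, f t = y x + s * ((b - x) * κ) := by
      intro x hx
      rw [← integral_add_adjacent_intervals (hfI _ a) (hfI _ _),
        p2 a ⟨by linarith, le_rfl⟩,
        intervalIntegral.integral_congr_ae (g := fun t => Q t * y t + u t - s * κ),
        intervalIntegral.integral_sub (hint a x).1 intervalIntegrable_const,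
        intervalIntegral.integral_const, smul_eq_mul, (heq a x).1, ha]
      · linear_combination (-s) * hκ1
      · refine Eventually.of_forall fun t ht => f3 t ?_
        rw [uIoc_of_le hx.1] at ht
        exact ⟨ht.1, ht.2.trans hx.2⟩
    have p4 : ∫ t in b..(b + 1), f t = 0 :=
      integral_zero_ae (Eventually.of_forall fun t ht => f4 t (by
        rw [uIoc_of_le (by linarith)] at ht; exact ht.1))
    have hpf := hpos.primitiveForm_nonneg hQ (c := a - 1) (d := b) (by linarith) hfL
      (fun x hx => by
        rw [mem_Icc, not_and_or, not_le, not_le] at hx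
        exact hx.elim (fun h => f1 x h.le) (f4 x)) (by
        rw [← integral_add_adjacent_intervals (hfI _ b) (hfI _ _), p4,
          p3 b ⟨hab.le, le_rfl⟩, hb]
        simp)
    set F : ℝ → ℝ := fun x => f x ^ 2 - 2 * ((Q x * ∫ t in (a - 1 - 1)..x, f t) * f x) with hF
    have hFint : IntegrableOn F (Ioc (a - 1 - 1) (b + 1)) :=
      (hfL.restrict _).integrable_sq.sub (((memLp_mul_primitive (by linarith) (hQ.memLp _ _)
        (hfL.restrict _)).1.integrable_mul (hfL.restrict _)).const_mul 2)
    have hFI : ∀ p q, a - 1 - 1 ≤ p → p ≤ q → q ≤ b + 1 → IntervalIntegrable F volume p q :=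
      fun p q h1 h2 h3 => (intervalIntegrable_iff_integrableOn_Ioc_of_le h2).2
        (hFint.mono_set (Ioc_subset_Ioc h1 h3))
    have e : primitiveForm Q (a - 1 - 1) (b + 1) f = s ^ 2 * A - 2 * s * u a := by
      have e1 : ∫ x in (a - 1 - 1)..(a - 1), F x = 0 :=
        integral_zero_ae (Eventually.of_forall fun t ht => by
          rw [uIoc_of_le (by linarith)] at ht
          simp [hF, f1 t ht.2])
      have e2 : ∫ x in (a - 1)..a, F x =
          s ^ 2 * ∫ x in (a - 1)..a, (1 - 2 * (Q x * (x - (a - 1)))) := by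
        rw [← intervalIntegral.integral_const_mul]
        refine intervalIntegral.integral_congr_ae (Eventually.of_forall fun t ht => ?_)
        rw [uIoc_of_le (by linarith)] at ht
        simp only [hF]
        rw [f2 t ht, p2 t (Ioc_subset_Icc_self ht)]
        ring
      have e4 : ∫ x in b..(b + 1), F x = 0 :=
        integral_zero_ae (Eventually.of_forall fun t ht => by
          rw [uIoc_of_le (by linarith)] at ht
          simp [hF, f4 t ht.1])
      have e3 : ∫ x in a..b, F x = - (2 * s * u a) +
          s ^ 2 * ∫ x in a..b, (κ ^ 2 + 2 * (Q x * ((b - x) * κ) * κ)) := by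
        have r1 := integral_mul_add_mul_eq_sub (hint a b).1 (hint a b).2
          (fun x => (heq a x).1) (fun x => (heq a x).2)
        have r2 := integral_mul_add_mul_eq_sub (v := fun x => (b - x) * κ) (f := fun _ => -κ)
          (intervalIntegrable_const) (hint a b).2 (fun x => by
            rw [intervalIntegral.integral_const, smul_eq_mul]; ring) (fun x => (heq a x).2)
        rw [ha, hb] at r1
        rw [sub_self, hκ1] at r2
        have i1 := ((hint a b).1.mul_continuousOn huc.continuousOn).add
          ((hint a b).2.continuousOn_mul hyc.continuousOn)
        have i2 := ((continuous_const (y := -κ)).mul huc |>.intervalIntegrable a b).add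
          ((hint a b).2.continuousOn_mul
            (by fun_prop : Continuous fun t => (b - t) * κ).continuousOn)
        have i3 : IntervalIntegrable
            (fun t => κ ^ 2 + 2 * (Q t * ((b - t) * κ) * κ)) volume a b := by
          refine intervalIntegrable_const.add (IntervalIntegrable.const_mul ?_ 2)
          simp only [mul_assoc]
          exact (hQ.intervalIntegrable a b).mul_continuousOn (by fun_prop)
        have hs : -(2 * s * u a) = (0 * u b - 0 * u a) + 2 * s * (0 * κ * u b - 1 * u a) := by ring
        rw [hs, ← r1, ← r2, ← intervalIntegral.integral_const_mul,
          ← intervalIntegral.integral_const_mul, ← intervalIntegral.integral_add,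
          ← intervalIntegral.integral_add]
        · refine intervalIntegral.integral_congr_ae (Eventually.of_forall fun t ht => ?_)
          rw [uIoc_of_le hab.le] at ht
          simp only [hF]
          rw [f3 t ht, p3 t (Ioc_subset_Icc_self ht)]
          ring
        exacts [i1.add (i2.const_mul _), i3.const_mul _, i1, i2.const_mul _]
      rw [primitiveForm, ← integral_of_le (by linarith : a - 1 - 1 ≤ b + 1)]
      change ∫ x in (a - 1 - 1)..(b + 1), F x = _
      rw [← integral_add_adjacent_intervals (b := b) (hFI _ _ le_rfl (by linarith) (by linarith))
          (hFI _ _ (by linarith) (by linarith) le_rfl),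
        ← integral_add_adjacent_intervals (b := a) (hFI _ _ le_rfl (by linarith) (by linarith))
          (hFI _ _ (by linarith) (by linarith) (by linarith)),
        ← integral_add_adjacent_intervals (b := a - 1)
          (hFI _ _ le_rfl (by linarith) (by linarith))
          (hFI _ _ (by linarith) (by linarith) (by linarith)), e1, e2, e3, e4, hA]
      ring
    rwa [e] at hpf
  by_contra hne
  have h1 := key (u a / (|A| + 1))
  have hA1 : 0 < |A| + 1 := by positivity
  have h2 : (u a / (|A| + 1)) ^ 2 * A - 2 * (u a / (|A| + 1)) * u a =
      u a ^ 2 * (A - 2 * (|A| + 1)) / (|A| + 1) ^ 2 := by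
    field_simp
  rw [h2] at h1
  have h3 : 0 < u a ^ 2 := by positivity
  have h4 : A - 2 * (|A| + 1) < 0 := by linarith [le_abs_self A, abs_nonneg A]
  exact absurd h1 (not_le.2 (div_neg_of_neg_of_pos (mul_neg_of_pos_of_neg h3 h4) (by positivity)))

/-- **Corollary (at most one zero).** If `Q ∈ L²_loc(ℝ)`, `q = Q'`, `L_q ≥ 0`, and `y` solves
`L_q y = 0` on `ℝ` (system sense) with `y a = y b = 0` for two distinct points `a ≠ b`, then
`y ≡ 0`; i.e. a not identically vanishing solution has at most one zero. -/
theorem at_most_one_zero (Q : ℝ → ℝ) (hQ : LocL2 Q) (hpos : LqNonneg Q)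
    (y : ℝ → ℝ) (hy : Solves Q y) (a b : ℝ) (hab : a ≠ b)
    (ha : y a = 0) (hb : y b = 0) :
    ∀ x : ℝ, y x = 0 := by
  obtain ⟨u, h⟩ := hy
  rcases lt_or_gt_of_ne hab with hab | hab
  · exact h.eq_zero hQ ha (h.quasiDeriv_eq_zero hQ hpos hab ha hb)
  · exact h.eq_zero hQ hb (h.quasiDeriv_eq_zero hQ hpos hab hb ha)
end
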